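/- There exist an irrational real number α, a nonnegative admissible test function f on ℝ⁵, a constant c > 0 and an integer N₀ ≥ 2 such that for all integers N ≥ N₀, R^(5)(N, α, f) ≥ c · N^{1/4} (log N)^{−5}. -/

import Mathlib

open MeasureTheory Filter

/-- The list of the fractional parts of `x 1, …, x N`, sorted in increasing order. -/
noncomputable def sortedFracParts (N : ℕ) (x : ℕ → ℝ) : List ℝ :=
  ((Finset.Icc 1 N).val.map fun n => Int.fract (x n)).sort (· ≤ ·)

/-- `nthBeta N x j` is `β_j`, the `j`-th smallest (1-indexed) among the fractional
parts of `x n`, `1 ≤ n ≤ N`. -/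
noncomputable def nthBeta (N : ℕ) (x : ℕ → ℝ) (j : ℕ) : ℝ :=
  (sortedFracParts N x).getD (j - 1) 0

/-- An admissible test function on `ℝ^m`: symmetric under permutations of the
coordinates, invariant under translations along the diagonal, and compactly
supported modulo the diagonal. -/
def IsAdmissible {m : ℕ} (f : (Fin m → ℝ) → ℝ) : Prop :=
  (∀ (σ : Equiv.Perm (Fin m)) (x : Fin m → ℝ), f (x ∘ σ) = f x) ∧
  (∀ (x : Fin m → ℝ) (t : ℝ), (f fun i => x i + t) = f x) ∧
  ∃ C : ℝ, ∀ x : Fin m → ℝ, f x ≠ 0 → ∀ i j, |x i - x j| ≤ C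

open Classical in
/-- The `m`-level correlation `R^(m)(N, x, f)` of the fractional parts of the
sequence `x 1, …, x N`. -/
noncomputable def corr (m N : ℕ) (x : ℕ → ℝ) (f : (Fin m → ℝ) → ℝ) : ℝ :=
  (N : ℝ)⁻¹ * ∑ j ∈ Finset.univ.filter (fun j : Fin m → Fin N => StrictMono j),
      f fun i => N * nthBeta N x ((j i : ℕ) + 1)

/-- `∫_{0 ≤ x₂ ≤ ⋯ ≤ x_{m+1}} f(0, x₂, …, x_{m+1}) dx₂ ⋯ dx_{m+1}`. -/
noncomputable def poissonValue (m : ℕ) (f : (Fin (m + 1) → ℝ) → ℝ) : ℝ :=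
  ∫ y in {y : Fin m → ℝ | (∀ i, 0 ≤ y i) ∧ Monotone y}, f (Fin.cons 0 y)

/-! ### Correlations of clustered sequences -/

/-- The indicator function of the points all of whose coordinates lie within distance `1` of each
other. -/
noncomputable def diagonalIndicator (m : ℕ) : (Fin m → ℝ) → ℝ :=
  Set.indicator {x | ∀ i j, |x i - x j| ≤ 1} 1

theorem diagonalIndicator_nonneg {m : ℕ} (x : Fin m → ℝ) : 0 ≤ diagonalIndicator m x :=
  Set.indicator_nonneg (fun _ _ => zero_le_one) x

theorem isAdmissible_diagonalIndicator (m : ℕ) : IsAdmissible (diagonalIndicator m) := by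
  classical
  refine ⟨fun σ x => ?_, fun x t => ?_, 1, fun x hx => ?_⟩
  · have h : (∀ i j, |x (σ i) - x (σ j)| ≤ 1) ↔ ∀ i j, |x i - x j| ≤ 1 :=
      ⟨fun h i j => by simpa using h (σ.symm i) (σ.symm j), fun h i j => h _ _⟩
    simp only [diagonalIndicator, Set.indicator_apply, Set.mem_ofPred_eq, Function.comp_apply, h,
      Pi.one_apply]
  · simp [diagonalIndicator, Set.indicator_apply]
  · exact Set.mem_of_indicator_ne_zero hx

theorem length_sortedFracParts (N : ℕ) (x : ℕ → ℝ) : (sortedFracParts N x).length = N := by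
  simp [sortedFracParts]

theorem map_nthBeta_eq (N : ℕ) (x : ℕ → ℝ) :
    (Finset.univ : Finset (Fin N)).val.map (fun i : Fin N => nthBeta N x ((i : ℕ) + 1)) =
      (Finset.Icc 1 N).val.map fun n => Int.fract (x n) := by
  have h : List.ofFn (fun i : Fin N => nthBeta N x ((i : ℕ) + 1)) = sortedFracParts N x := by
    apply List.ext_getElem
    · simp [length_sortedFracParts]
    · intro i h₁ h₂
      simp [nthBeta, h₂]
  rw [Fin.univ_val_map, h, sortedFracParts, Multiset.sort_eq]

/-- The indices of the ordered fractional parts satisfying `P` are as many as the terms satisfying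
`P`. -/
theorem card_filter_nthBeta (N : ℕ) (x : ℕ → ℝ) (P : ℝ → Prop) [DecidablePred P] :
    (Finset.univ.filter fun i : Fin N => P (nthBeta N x ((i : ℕ) + 1))).card =
      ((Finset.Icc 1 N).filter fun n => P (Int.fract (x n))).card := by
  have h := congrArg (Multiset.countP P) (map_nthBeta_eq N x)
  rwa [Multiset.countP_map, Multiset.countP_map] at h

open Classical in
/-- A finset of size `n` in a linear order contains at least `n.choose m` strictly increasing
sequences of length `m`. -/
theorem choose_le_card_strictMono {N : ℕ} (m : ℕ) (J : Finset (Fin N)) :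
    J.card.choose m ≤
      (Finset.univ.filter fun j : Fin m → Fin N => StrictMono j ∧ ∀ i, j i ∈ J).card := by
  rw [← Finset.card_powersetCard]
  refine Finset.card_le_card_of_surjOn (fun j => Finset.univ.image j) fun s hs => ?_
  obtain ⟨hsJ, hs⟩ := Finset.mem_powersetCard.1 (Finset.mem_coe.1 hs)
  refine ⟨s.orderEmbOfFin hs, ?_, ?_⟩
  · simp only [Finset.coe_filter, Finset.mem_univ, true_and, Set.mem_ofPred_eq]
    exact ⟨(s.orderEmbOfFin hs).strictMono, fun i => hsJ (s.orderEmbOfFin_mem hs i)⟩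
  · exact s.image_orderEmbOfFin_univ hs

/-- If many fractional parts lie in a common interval of length `1 / N`, the correlation is
large. -/
theorem choose_div_le_corr {m N K : ℕ} (x : ℕ → ℝ) (a : ℝ) (S : Finset ℕ)
    (hS : S ⊆ Finset.Icc 1 N) (hK : K ≤ S.card)
    (h : ∀ n ∈ S, a ≤ Int.fract (x n) ∧ N * (Int.fract (x n) - a) ≤ 1) :
    (N : ℝ)⁻¹ * K.choose m ≤ corr m N x (diagonalIndicator m) := by
  classical
  set J : Finset (Fin N) := Finset.univ.filter fun i : Fin N =>
    a ≤ nthBeta N x ((i : ℕ) + 1) ∧ N * (nthBeta N x ((i : ℕ) + 1) - a) ≤ 1 with hJ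
  have hKJ : K ≤ J.card := by
    rw [hJ, card_filter_nthBeta N x fun y => a ≤ y ∧ N * (y - a) ≤ 1]
    exact hK.trans (Finset.card_le_card fun n hn => Finset.mem_filter.2 ⟨hS hn, h n hn⟩)
  unfold corr
  gcongr
  have hcard : (K.choose m : ℝ) ≤
      ((Finset.univ.filter fun j : Fin m → Fin N => StrictMono j ∧ ∀ i, j i ∈ J).card : ℝ) :=
    mod_cast (Nat.choose_le_choose m hKJ).trans (choose_le_card_strictMono m J)
  refine hcard.trans ?_
  rw [Finset.card_eq_sum_ones, Nat.cast_sum, ← Finset.filter_filter]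
  refine (Finset.sum_le_sum fun j hj => ?_).trans
    (Finset.sum_le_sum_of_subset_of_nonneg (Finset.filter_subset _ _)
      fun j _ _ => diagonalIndicator_nonneg _)
  have hmem : ∀ i, a ≤ nthBeta N x ((j i : ℕ) + 1) ∧
      N * (nthBeta N x ((j i : ℕ) + 1) - a) ≤ 1 := fun i =>
    (Finset.mem_filter.1 ((Finset.mem_filter.1 hj).2 i)).2
  rw [diagonalIndicator, Set.indicator_of_mem]
  · simp
  · intro i k
    have hN : (0 : ℝ) ≤ N := N.cast_nonneg
    have hi := mul_nonneg hN (sub_nonneg.2 (hmem i).1)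
    have hk := mul_nonneg hN (sub_nonneg.2 (hmem k).1)
    rw [abs_le]
    constructor <;> linarith [(hmem i).2, (hmem k).2]

/-! ### An irrational whose convergents have square denominators -/

/-- The sequence `1, 1, 2, 5, 27, …` whose squares are the denominators of the convergents. -/
def rootDenom : ℕ → ℕ
  | 0 => 1
  | 1 => 1
  | k + 2 => rootDenom (k + 1) ^ 2 + rootDenom k

/-- The numerators of the convergents. -/
def numer : ℕ → ℕ
  | 0 => 0
  | 1 => 1
  | k + 2 => (rootDenom (k + 2) + rootDenom k) * numer (k + 1) + numer k

theorem rootDenom_pos : ∀ k, 0 < rootDenom k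
  | 0 => one_pos
  | 1 => one_pos
  | k + 2 => by
    rw [rootDenom]
    exact Nat.add_pos_right _ (rootDenom_pos k)

theorem rootDenom_lt_succ (k : ℕ) : rootDenom (k + 1) < rootDenom (k + 2) := by
  rw [rootDenom]
  nlinarith [rootDenom_pos k, rootDenom_pos (k + 1)]

theorem monotone_rootDenom : Monotone rootDenom := by
  refine monotone_nat_of_le_succ fun k => ?_
  cases k with
  | zero => simp [rootDenom]
  | succ k => exact (rootDenom_lt_succ k).le

theorem le_rootDenom : ∀ k, k ≤ rootDenom k
  | 0 => Nat.zero_le _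
  | 1 => le_rfl
  | k + 2 => (le_rootDenom (k + 1)).trans_lt (rootDenom_lt_succ k)

theorem numer_mul_sub_mul_numer (k : ℕ) :
    (numer (k + 1) : ℝ) * (rootDenom k : ℝ) ^ 2 - numer k * (rootDenom (k + 1) : ℝ) ^ 2 =
      (-1) ^ k := by
  induction k with
  | zero => simp [numer, rootDenom]
  | succ k ih =>
    have hp : (numer (k + 2) : ℝ) =
        (rootDenom (k + 2) + rootDenom k) * numer (k + 1) + numer k := by
      rw [numer]; push_cast; ring
    have hq : (rootDenom (k + 2) : ℝ) = (rootDenom (k + 1) : ℝ) ^ 2 + rootDenom k := by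
      rw [rootDenom]; push_cast; ring
    rw [pow_succ (-1 : ℝ) k]
    linear_combination (rootDenom (k + 1) : ℝ) ^ 2 * hp -
      numer (k + 1) * ((rootDenom (k + 2) : ℝ) + rootDenom k) * hq - ih

/-- The gap between consecutive convergents. -/
noncomputable def gap (k : ℕ) : ℝ := 1 / ((rootDenom k : ℝ) ^ 2 * (rootDenom (k + 1) : ℝ) ^ 2)

theorem gap_pos (k : ℕ) : 0 < gap k := by
  have h₁ := rootDenom_pos k
  have h₂ := rootDenom_pos (k + 1)
  unfold gap
  positivity

theorem antitone_gap : Antitone gap := by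
  intro k l hkl
  have h₁ : (0 : ℝ) < rootDenom k := mod_cast rootDenom_pos k
  have h₂ : (0 : ℝ) < rootDenom (k + 1) := mod_cast rootDenom_pos (k + 1)
  have h₃ : (rootDenom k : ℝ) ≤ rootDenom l := mod_cast monotone_rootDenom hkl
  have h₄ : (rootDenom (k + 1) : ℝ) ≤ rootDenom (l + 1) :=
    mod_cast monotone_rootDenom (Nat.succ_le_succ hkl)
  unfold gap
  gcongr

theorem gap_le (k : ℕ) : gap k ≤ 1 / ((k : ℝ) + 1) := by
  have h₁ : (1 : ℝ) ≤ rootDenom k := mod_cast rootDenom_pos k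
  have h₂ : (k : ℝ) + 1 ≤ rootDenom (k + 1) := mod_cast le_rootDenom (k + 1)
  have h₃ : (1 : ℝ) ≤ rootDenom (k + 1) := mod_cast rootDenom_pos (k + 1)
  unfold gap
  gcongr
  nlinarith [one_le_pow₀ h₁ (n := 2)]

theorem tendsto_gap : Tendsto gap atTop (nhds 0) :=
  squeeze_zero (fun k => (gap_pos k).le) gap_le tendsto_one_div_add_atTop_nhds_zero_nat

theorem convergent_succ_sub (k : ℕ) :
    (numer (k + 1) : ℝ) / (rootDenom (k + 1) : ℝ) ^ 2 - numer k / (rootDenom k : ℝ) ^ 2 =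
      (-1) ^ k * gap k := by
  have h₁ : (rootDenom k : ℝ) ≠ 0 := mod_cast (rootDenom_pos k).ne'
  have h₂ : (rootDenom (k + 1) : ℝ) ≠ 0 := mod_cast (rootDenom_pos (k + 1)).ne'
  rw [← numer_mul_sub_mul_numer k, gap]
  field_simp

theorem convergent_eq_sum (k : ℕ) :
    (numer k : ℝ) / (rootDenom k : ℝ) ^ 2 = ∑ i ∈ Finset.range k, (-1) ^ i * gap i := by
  induction k with
  | zero => simp [numer]
  | succ k ih => rw [Finset.sum_range_succ, ← ih, ← convergent_succ_sub]; ring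

theorem exists_abs_sub_convergent_le :
    ∃ α : ℝ, ∀ k, |α - numer k / (rootDenom k : ℝ) ^ 2| ≤ gap k := by
  obtain ⟨α, hα⟩ := antitone_gap.tendsto_alternating_series_of_tendsto_zero tendsto_gap
  refine ⟨α, fun k => ?_⟩
  have hs := convergent_succ_sub k
  rw [convergent_eq_sum, convergent_eq_sum] at hs
  rw [convergent_eq_sum, abs_le]
  have hg := gap_pos k
  obtain ⟨l, rfl | rfl⟩ := k.even_or_odd'
  · have h₁ := antitone_gap.alternating_series_le_tendsto hα l
    have h₂ := antitone_gap.tendsto_le_alternating_series hα l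
    rw [pow_mul, neg_one_sq, one_pow] at hs
    constructor <;> linarith
  · have h₁ := antitone_gap.alternating_series_le_tendsto hα (l + 1)
    have h₂ := antitone_gap.tendsto_le_alternating_series hα l
    rw [pow_succ, pow_mul, neg_one_sq, one_pow] at hs
    rw [show 2 * (l + 1) = 2 * l + 1 + 1 by ring] at h₁
    constructor <;> linarith

theorem irrational_of_abs_sub_convergent_le {α : ℝ}
    (hα : ∀ k, |α - numer k / (rootDenom k : ℝ) ^ 2| ≤ gap k) : Irrational α := by
  rintro ⟨r, rfl⟩
  have hb : (0 : ℝ) < r.den := mod_cast r.den_pos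
  have key : ∀ k, r.den ≤ k → (r : ℝ) = numer k / (rootDenom k : ℝ) ^ 2 := by
    intro k hk
    have h₁ : (0 : ℝ) < rootDenom k := mod_cast rootDenom_pos k
    have h₂ : (0 : ℝ) < rootDenom (k + 1) := mod_cast rootDenom_pos (k + 1)
    have h₃ : (r.den : ℝ) < (rootDenom (k + 1) : ℝ) ^ 2 := by
      have h : r.den < rootDenom (k + 1) ^ 2 := by nlinarith [le_rootDenom (k + 1)]
      exact_mod_cast h
    have hr : (r : ℝ) = r.num / r.den := mod_cast (Rat.num_div_den r).symm
    have hcast : (r : ℝ) - numer k / (rootDenom k : ℝ) ^ 2 =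
        ((r.num * (rootDenom k : ℤ) ^ 2 - numer k * r.den : ℤ) : ℝ) /
          (r.den * (rootDenom k : ℝ) ^ 2) := by
      rw [hr]; push_cast; field_simp
    have h := hα k
    rw [hcast, abs_div, abs_of_pos (by positivity : (0 : ℝ) < r.den * (rootDenom k : ℝ) ^ 2),
      div_le_iff₀ (by positivity)] at h
    have hlt : gap k * (r.den * (rootDenom k : ℝ) ^ 2) < 1 := by
      have : gap k * (r.den * (rootDenom k : ℝ) ^ 2) = r.den / (rootDenom (k + 1) : ℝ) ^ 2 := by
        unfold gap; field_simp
      rwa [this, div_lt_one (by positivity)]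
    have hz : r.num * (rootDenom k : ℤ) ^ 2 - numer k * r.den = 0 :=
      Int.abs_lt_one_iff.1 (mod_cast h.trans_lt hlt)
    rw [hz, Int.cast_zero, zero_div] at hcast
    linarith
  have h := convergent_succ_sub r.den
  rw [← key _ le_rfl, ← key _ (Nat.le_succ _), sub_self] at h
  exact mul_ne_zero (pow_ne_zero _ (by norm_num)) (gap_pos r.den).ne' h.symm

/-! ### Clusters of the sequence `n ^ 2 * α` -/

/-- Multiples of `q` give a cluster in the fractional parts of `n ^ 2 * α` when `α` is close to a
fraction with denominator `q ^ 2`. -/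
theorem choose_div_le_corr_sq_mul {α : ℝ} {p q N K : ℕ} (m : ℕ) (hN : 2 ≤ N) (hq : 0 < q)
    (hKq : K * q ≤ N) (hα : N * ((K * q : ℝ) ^ 2 * |α - p / (q : ℝ) ^ 2|) ≤ 1) :
    (N : ℝ)⁻¹ * K.choose m ≤ corr m N (fun n => (n : ℝ) ^ 2 * α) (diagonalIndicator m) := by
  set θ : ℝ := α - p / (q : ℝ) ^ 2 with hθ
  have hq' : (0 : ℝ) < q := mod_cast hq
  have hN' : (2 : ℝ) ≤ N := mod_cast hN
  set S : Finset ℕ := (Finset.Icc 1 K).image (· * q) with hS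
  have hcard : K ≤ S.card := by
    rw [hS, Finset.card_image_of_injective _ (mul_left_injective₀ hq.ne')]
    simp
  have hsub : S ⊆ Finset.Icc 1 N := by
    intro n hn
    obtain ⟨l, hl, rfl⟩ := Finset.mem_image.1 hn
    rw [Finset.mem_Icc] at hl ⊢
    exact ⟨Nat.mul_pos hl.1 hq, (Nat.mul_le_mul_right q hl.2).trans hKq⟩
  have hsmall : ∀ l : ℕ, l ≤ K → N * ((l * q : ℝ) ^ 2 * |θ|) ≤ 1 := by
    intro l hl
    refine le_trans ?_ hα
    have : (l : ℝ) ≤ K := mod_cast hl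
    gcongr
  have hfract : ∀ l : ℕ, Int.fract (((l * q : ℕ) : ℝ) ^ 2 * α) =
      Int.fract ((l * q : ℝ) ^ 2 * θ) := by
    intro l
    have : ((l * q : ℕ) : ℝ) ^ 2 * α = (l * q : ℝ) ^ 2 * θ + ((l ^ 2 * p : ℕ) : ℝ) := by
      rw [hθ]; push_cast; field_simp; ring
    rw [this, Int.fract_add_natCast]
  rcases le_or_gt 0 θ with h0 | h0
  · refine choose_div_le_corr _ 0 S hsub hcard fun n hn => ⟨Int.fract_nonneg _, ?_⟩
    obtain ⟨l, hl, rfl⟩ := Finset.mem_image.1 hn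
    have h := hsmall l (Finset.mem_Icc.1 hl).2
    rw [abs_of_nonneg h0] at h
    have hpos : 0 ≤ (l * q : ℝ) ^ 2 * θ := by positivity
    rw [hfract, Int.fract_eq_self.2 ⟨hpos, by nlinarith⟩]
    linarith
  · refine choose_div_le_corr _ (1 - (N : ℝ)⁻¹) S hsub hcard fun n hn => ?_
    obtain ⟨l, hl, rfl⟩ := Finset.mem_image.1 hn
    have h := hsmall l (Finset.mem_Icc.1 hl).2
    have hl0 : (0 : ℝ) < l := mod_cast (Finset.mem_Icc.1 hl).1
    rw [abs_of_neg h0] at h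
    have hneg : 0 < (l * q : ℝ) ^ 2 * -θ := mul_pos (by positivity) (neg_pos.2 h0)
    have hNinv : (l * q : ℝ) ^ 2 * -θ ≤ (N : ℝ)⁻¹ := by
      rw [← one_div, le_div_iff₀ (by positivity)]
      linarith
    have hNhalf : (N : ℝ)⁻¹ ≤ 1 / 2 := by
      rw [← one_div]
      gcongr
    have hfr : Int.fract ((l * q : ℝ) ^ 2 * θ) = (l * q : ℝ) ^ 2 * θ + 1 := by
      rw [← Int.fract_add_one, Int.fract_eq_self]
      constructor <;> linarith
    rw [hfract, hfr]
    refine ⟨by linarith, ?_⟩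
    have : (N : ℝ) * ((l * q : ℝ) ^ 2 * θ + 1 - (1 - (N : ℝ)⁻¹)) =
        1 - N * ((l * q : ℝ) ^ 2 * -θ) := by
      field_simp
      ring
    rw [this]
    have : 0 ≤ N * ((l * q : ℝ) ^ 2 * -θ) := by positivity
    linarith

theorem exists_rootDenom_pow_le_lt {M : ℕ} (hM : 1 ≤ M) :
    ∃ k, rootDenom k ^ 4 ≤ M ∧ M < rootDenom (k + 1) ^ 4 := by
  classical
  have hex : ∃ k, M < rootDenom k ^ 4 :=
    ⟨M + 1, ((Nat.lt_succ_self M).trans_le (le_rootDenom _)).trans_le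
      (Nat.le_self_pow (by norm_num) _)⟩
  have hpos : Nat.find hex ≠ 0 := by
    intro h
    have := Nat.find_spec hex
    rw [h] at this
    simp [rootDenom] at this
    omega
  obtain ⟨k, hk⟩ := Nat.exists_eq_succ_of_ne_zero hpos
  refine ⟨k, not_lt.1 (Nat.find_min hex (hk ▸ Nat.lt_succ_self k)), ?_⟩
  have := Nat.find_spec hex
  rwa [hk] at this

theorem choose_div_le_corr_of_pow_le {α : ℝ}
    (hα : ∀ k, |α - numer k / (rootDenom k : ℝ) ^ 2| ≤ gap k) {N K : ℕ} (m : ℕ) (hN : 2 ≤ N)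
    (hK : K ^ 4 ≤ N) :
    (N : ℝ)⁻¹ * K.choose m ≤ corr m N (fun n => (n : ℝ) ^ 2 * α) (diagonalIndicator m) := by
  obtain ⟨k, hk₁, hk₂⟩ := exists_rootDenom_pow_le_lt (Nat.one_le_pow 3 N (by omega))
  have h₁ : (0 : ℝ) < rootDenom k := mod_cast rootDenom_pos k
  have h₂ : (0 : ℝ) < rootDenom (k + 1) := mod_cast rootDenom_pos (k + 1)
  refine choose_div_le_corr_sq_mul (p := numer k) m hN (rootDenom_pos k) ?_ ?_
  · refine le_of_pow_le_pow_left₀ (n := 4) (by norm_num) (Nat.zero_le _) ?_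
    calc (K * rootDenom k) ^ 4 = K ^ 4 * rootDenom k ^ 4 := mul_pow _ _ _
      _ ≤ N * N ^ 3 := Nat.mul_le_mul hK hk₁
      _ = N ^ 4 := by ring
  · have hcast : N * K ^ 2 ≤ rootDenom (k + 1) ^ 2 := by
      refine le_of_pow_le_pow_left₀ (n := 2) (by norm_num) (Nat.zero_le _) ?_
      calc (N * K ^ 2) ^ 2 = N ^ 2 * K ^ 4 := by ring
        _ ≤ N ^ 2 * N := Nat.mul_le_mul_left _ hK
        _ = N ^ 3 := by ring
        _ ≤ rootDenom (k + 1) ^ 4 := hk₂.le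
        _ = (rootDenom (k + 1) ^ 2) ^ 2 := by ring
    calc (N : ℝ) * ((K * rootDenom k : ℝ) ^ 2 * |α - numer k / (rootDenom k : ℝ) ^ 2|)
        ≤ N * ((K * rootDenom k : ℝ) ^ 2 * gap k) := by gcongr; exact hα k
      _ = (N * K ^ 2 : ℝ) / (rootDenom (k + 1) : ℝ) ^ 2 := by unfold gap; field_simp
      _ ≤ 1 := (div_le_one (by positivity)).2 (mod_cast hcast)

theorem exists_pow_four_le_lt (N : ℕ) : ∃ K, K ^ 4 ≤ N ∧ N < (K + 1) ^ 4 := by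
  refine ⟨N.sqrt.sqrt, ?_, ?_⟩
  · calc N.sqrt.sqrt ^ 4 = (N.sqrt.sqrt ^ 2) ^ 2 := by ring
      _ ≤ N.sqrt ^ 2 := Nat.pow_le_pow_left (Nat.sqrt_le' _) 2
      _ ≤ N := Nat.sqrt_le' _
  · calc N < (N.sqrt + 1) ^ 2 := Nat.lt_succ_sqrt' _
      _ ≤ ((N.sqrt.sqrt + 1) ^ 2) ^ 2 := Nat.pow_le_pow_left (Nat.lt_succ_sqrt' _) 2
      _ = (N.sqrt.sqrt + 1) ^ 4 := by ring

theorem rpow_quarter_le_choose_five_div {N K : ℕ} (hK : 7 ≤ K) (hN : N < (K + 1) ^ 4)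
    (hN₀ : 0 < N) :
    1 / 29160 * (N : ℝ) ^ ((1 : ℝ) / 4) ≤ (N : ℝ)⁻¹ * K.choose 5 := by
  have hN' : (0 : ℝ) < N := mod_cast hN₀
  set u : ℝ := (N : ℝ) ^ ((1 : ℝ) / 4) with hu
  have hu0 : 0 < u := by positivity
  have hu4 : u ^ 4 = N := by
    rw [hu, ← Real.rpow_natCast, ← Real.rpow_mul hN'.le]
    norm_num
  have huK : u ≤ K + 1 := by
    refine le_of_pow_le_pow_left₀ (n := 4) (by norm_num) (by positivity) ?_
    rw [hu4]
    exact_mod_cast hN.le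
  have hchoose : ((K + 1 - 5 : ℕ) : ℝ) ^ 5 ≤ 120 * K.choose 5 := by
    have h := Nat.pow_sub_le_descFactorial K 5
    rw [Nat.descFactorial_eq_factorial_mul_choose] at h
    exact_mod_cast h
  have hthird : u / 3 ≤ ((K + 1 - 5 : ℕ) : ℝ) := by
    have h : K + 1 ≤ 3 * (K + 1 - 5) := by omega
    have h' : (K : ℝ) + 1 ≤ 3 * ((K + 1 - 5 : ℕ) : ℝ) := mod_cast h
    linarith
  have hpow : (u / 3) ^ 5 ≤ 120 * K.choose 5 :=
    (pow_le_pow_left₀ (by positivity) hthird 5).trans hchoose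
  rw [inv_mul_eq_div, le_div_iff₀ hN', ← hu4]
  nlinarith [hpow]

/-- **Theorem 2(a).** There is an irrational `α` and a nonnegative admissible test
function `f` on `ℝ⁵` such that `R⁵(N, α, f) ≫ N^{1/4} (log N)^{-5}`. -/
theorem exists_alpha_five_level_correlation_diverges :
    ∃ α : ℝ, Irrational α ∧
      ∃ f : (Fin 5 → ℝ) → ℝ, IsAdmissible f ∧ (∀ x, 0 ≤ f x) ∧
        ∃ c : ℝ, 0 < c ∧ ∃ N₀ : ℕ, 2 ≤ N₀ ∧ ∀ N : ℕ, N₀ ≤ N →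
          c * (N : ℝ) ^ ((1 : ℝ) / 4) / (Real.log N) ^ 5
            ≤ corr 5 N (fun n => (n : ℝ) ^ 2 * α) f := by
  obtain ⟨α, hα⟩ := exists_abs_sub_convergent_le
  refine ⟨α, irrational_of_abs_sub_convergent_le hα, diagonalIndicator 5,
    isAdmissible_diagonalIndicator 5, diagonalIndicator_nonneg, 1 / 29160, by norm_num, 10000,
    by norm_num, fun N hN => ?_⟩
  obtain ⟨K, hK, hNK⟩ := exists_pow_four_le_lt N
  have hK7 : 7 ≤ K := by
    by_contra! h
    have : (K + 1) ^ 4 ≤ 7 ^ 4 := Nat.pow_le_pow_left (by omega) 4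
    omega
  refine le_trans ?_ ((rpow_quarter_le_choose_five_div hK7 hNK (by omega)).trans
    (choose_div_le_corr_of_pow_le hα 5 (by omega) hK))
  have hlog : 1 ≤ Real.log N := by
    rw [Real.le_log_iff_exp_le (by positivity)]
    have : (10000 : ℝ) ≤ N := mod_cast hN
    linarith [Real.exp_one_lt_d9]
  exact div_le_self (by positivity) (one_le_pow₀ hlog)
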